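/- Over the field F_2 with two elements, let R^(1) = [[1,0,0],[0,1,0],[1,0,1]], R^(2) = [[1,0,1],[0,1,0],[0,0,1]], R^(3) = [[0,1,0],[1,0,0],[0,0,1]], and for m = 1,2,3,4 let 𝒯^m_{356} := 𝒬(R^(4,m)_{356}) + 𝒬(Q^(4,m)_{356}), where the four pairs (R^(4,m), Q^(4,m)) are ([[1,0,0],[0,1,0],[0,0,1]], [[1,1,0],[0,1,0],[0,0,1]]), ([[1,1,0],[0,1,0],[0,1,1]], [[1,0,0],[0,1,0],[0,1,1]]), ([[1,0,1],[0,1,0],[0,0,1]], [[1,1,1],[0,1,0],[0,0,1]]), ([[1,0,1],[0,1,0],[0,1,1]], [[1,1,1],[0,1,0],[0,1,1]]). Then for all complex numbers c_1, c_2, c_3, c_4, setting 𝒯_{356} := c_1 𝒯^1_{356} + c_2 𝒯^2_{356} + c_3 𝒯^3_{356} + c_4 𝒯^4_{356}, the quantum tetrahedron relation ℛ^(1)_{123} ℛ^(2)_{145} ℛ^(3)_{246} 𝒯_{356} = 𝒯_{356} ℛ^(3)_{246} ℛ^(2)_{145} ℛ^(1)_{123} holds. -/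

import Mathlib

open Matrix

/-- For a 3×3 matrix `R` over `F` and distinct indices `i j k : Fin 6`, the 6×6 matrix
which equals `R` on the rows and columns `i, j, k` and the identity elsewhere. -/
def embed {F : Type*} [Zero F] [One F] (R : Matrix (Fin 3) (Fin 3) F)
    (i j k : Fin 6) : Matrix (Fin 6) (Fin 6) F := fun a b =>
  if a = i then (if b = i then R 0 0 else if b = j then R 0 1 else if b = k then R 0 2 else 0)
  else if a = j then (if b = i then R 1 0 else if b = j then R 1 1 else if b = k then R 1 2 else 0)
  else if a = k then (if b = i then R 2 0 else if b = j then R 2 1 else if b = k then R 2 2 else 0)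
  else if a = b then 1 else 0

/-- The quantization of a 6×6 matrix `M` over `ZMod 2`. -/
def quant (M : Matrix (Fin 6) (Fin 6) (ZMod 2)) :
    Matrix (Fin 6 → ZMod 2) (Fin 6 → ZMod 2) ℂ :=
  fun x y => if Matrix.vecMul x M = y then 1 else 0

theorem quant_mul (A B : Matrix (Fin 6) (Fin 6) (ZMod 2)) :
    quant A * quant B = quant (A * B) := by
  ext x y
  simp only [quant, Matrix.mul_apply, ← Matrix.vecMul_vecMul]
  rw [Finset.sum_eq_single (Matrix.vecMul x A)]
  · simp
  · intro j _ hj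
    simp [hj.symm]
  · simp

theorem modified_example4_quantum (c1 c2 c3 c4 : ℂ) :
    let R1 : Matrix (Fin 3) (Fin 3) (ZMod 2) := !![1,0,0; 0,1,0; 1,0,1]
    let R2 : Matrix (Fin 3) (Fin 3) (ZMod 2) := !![1,0,1; 0,1,0; 0,0,1]
    let R3 : Matrix (Fin 3) (Fin 3) (ZMod 2) := !![0,1,0; 1,0,0; 0,0,1]
    let T1 := quant (embed (!![1,0,0; 0,1,0; 0,0,1] : Matrix (Fin 3) (Fin 3) (ZMod 2)) 2 4 5) +
              quant (embed (!![1,1,0; 0,1,0; 0,0,1] : Matrix (Fin 3) (Fin 3) (ZMod 2)) 2 4 5)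
    let T2 := quant (embed (!![1,1,0; 0,1,0; 0,1,1] : Matrix (Fin 3) (Fin 3) (ZMod 2)) 2 4 5) +
              quant (embed (!![1,0,0; 0,1,0; 0,1,1] : Matrix (Fin 3) (Fin 3) (ZMod 2)) 2 4 5)
    let T3 := quant (embed (!![1,0,1; 0,1,0; 0,0,1] : Matrix (Fin 3) (Fin 3) (ZMod 2)) 2 4 5) +
              quant (embed (!![1,1,1; 0,1,0; 0,0,1] : Matrix (Fin 3) (Fin 3) (ZMod 2)) 2 4 5)
    let T4 := quant (embed (!![1,0,1; 0,1,0; 0,1,1] : Matrix (Fin 3) (Fin 3) (ZMod 2)) 2 4 5) +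
              quant (embed (!![1,1,1; 0,1,0; 0,1,1] : Matrix (Fin 3) (Fin 3) (ZMod 2)) 2 4 5)
    let T := c1 • T1 + c2 • T2 + c3 • T3 + c4 • T4
    quant (embed R1 0 1 2) * quant (embed R2 0 3 4) * quant (embed R3 1 3 5) * T =
      T * quant (embed R3 1 3 5) * quant (embed R2 0 3 4) * quant (embed R1 0 1 2) := by
  intro R1 R2 R3 T1 T2 T3 T4 T
  have key : ∀ A B : Matrix (Fin 6) (Fin 6) (ZMod 2),
      embed R1 0 1 2 * embed R2 0 3 4 * embed R3 1 3 5 * A =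
        B * embed R3 1 3 5 * embed R2 0 3 4 * embed R1 0 1 2 →
      quant (embed R1 0 1 2) * quant (embed R2 0 3 4) * quant (embed R3 1 3 5) * quant A =
      quant B * quant (embed R3 1 3 5) * quant (embed R2 0 3 4) * quant (embed R1 0 1 2) := by
    intro A B h
    simp only [quant_mul, h]
  simp only [T, T1, T2, T3, T4, mul_add, add_mul, mul_smul_comm, smul_mul_assoc, smul_add]
  rw [key (embed !![1,0,0; 0,1,0; 0,0,1] 2 4 5) (embed !![1,1,0; 0,1,0; 0,0,1] 2 4 5) (by decide +kernel),
    key (embed !![1,1,0; 0,1,0; 0,0,1] 2 4 5) (embed !![1,0,0; 0,1,0; 0,0,1] 2 4 5) (by decide +kernel)]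
  rw [key (embed !![1,1,0; 0,1,0; 0,1,1] 2 4 5) (embed !![1,0,0; 0,1,0; 0,1,1] 2 4 5) (by decide +kernel),
    key (embed !![1,0,0; 0,1,0; 0,1,1] 2 4 5) (embed !![1,1,0; 0,1,0; 0,1,1] 2 4 5) (by decide +kernel)]
  rw [key (embed !![1,0,1; 0,1,0; 0,0,1] 2 4 5) (embed !![1,1,1; 0,1,0; 0,0,1] 2 4 5) (by decide +kernel),
    key (embed !![1,1,1; 0,1,0; 0,0,1] 2 4 5) (embed !![1,0,1; 0,1,0; 0,0,1] 2 4 5) (by decide +kernel)]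
  rw [key (embed !![1,0,1; 0,1,0; 0,1,1] 2 4 5) (embed !![1,1,1; 0,1,0; 0,1,1] 2 4 5) (by decide +kernel),
    key (embed !![1,1,1; 0,1,0; 0,1,1] 2 4 5) (embed !![1,0,1; 0,1,0; 0,1,1] 2 4 5) (by decide +kernel)]
  abel
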